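/- arXiv:1803.04020 — 2 statements merged into one kernel-verified Lean document; each statement's English description precedes it below -/
import Mathlib

section
/- For every prime power q ≥ 3 and every positive integer k, there exists a positive integer n and an [n,k]_q maximum weight spectrum code. -/
/-- The Hamming weight of a vector: the number of nonzero coordinates. -/
def wt {ι F : Type*} [Fintype ι] [Zero F] [DecidableEq F] (c : ι → F) : ℕ :=
  (Finset.univ.filter fun i => c i ≠ 0).card

/-- The weight set of a code: the set of nonzero weights of nonzero codewords. -/
def wtSet {ι F : Type*} [Fintype ι] [Zero F] [DecidableEq F] (C : Set (ι → F)) : Set ℕ :=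
  {w | ∃ c ∈ C, c ≠ 0 ∧ wt c = w}

/-- A vector is a multiple of any vector annihilated by the same linear functionals. -/
lemma exists_smul_eq_of_dual_ne_zero_iff {F V : Type*} [Field F] [AddCommGroup V] [Module F V]
    {u v : V} (h : ∀ d : Module.Dual F V, d u ≠ 0 ↔ d v ≠ 0) : ∃ a : F, a • v = u := by
  rw [← Submodule.mem_span_singleton]
  by_contra hu
  obtain ⟨d, hdu, hd⟩ := Submodule.exists_le_ker_of_notMem hu
  exact (h d).1 hdu (hd (Submodule.mem_span_singleton_self v))

lemma wt_units_smul {ι F : Type*} [Fintype ι] [Field F] [DecidableEq F] (a : Fˣ) (c : ι → F) :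
    wt (a • c) = wt c := by
  simp [wt, Units.smul_def]

lemma wt_comp_equiv {ι κ F : Type*} [Fintype ι] [Fintype κ] [Zero F] [DecidableEq F]
    (σ : κ ≃ ι) (c : ι → F) : wt (c ∘ σ) = wt c := by
  simp only [wt, Finset.card_filter]
  exact Equiv.sum_comp σ fun i => if c i ≠ 0 then 1 else 0

/-- Repeating each coordinate `d` exactly `m d` times weights the coordinates by `m`. -/
lemma wt_sigma_fin {D F : Type*} [Fintype D] [Zero F] [DecidableEq F] (m : D → ℕ) (c : D → F) :
    wt (fun i : Σ d, Fin (m d) => c i.1) = ∑ d with c d ≠ 0, m d := by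
  simp only [wt, Finset.card_filter, Fintype.sum_sigma, Finset.sum_filter]
  exact Finset.sum_congr rfl fun d _ => by by_cases h : c d = 0 <;> simp [h]

/-- Distinct supports are separated by weighting coordinates with distinct powers of two. -/
lemma iff_of_sum_two_pow_eq {D : Type*} [Fintype D] {e : D → ℕ} (he : Function.Injective e)
    {p r : D → Prop} [DecidablePred p] [DecidablePred r]
    (h : ∑ d with p d, 2 ^ e d = ∑ d with r d, 2 ^ e d) (d : D) : p d ↔ r d := by
  have key := @Finset.geomSum_injective 2 le_rfl
    (Finset.univ.filter p |>.map ⟨e, he⟩) (Finset.univ.filter r |>.map ⟨e, he⟩)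
    (by simpa [Finset.sum_map] using h)
  simpa using Finset.ext_iff.1 (Finset.map_injective _ key) d

/-- For every prime power `q ≥ 3` and every positive integer `k`, there exists a positive
integer `n` and an `[n,k]_q` maximum weight spectrum code. -/
theorem exists_MWS (q k : ℕ) (hq : IsPrimePow q) (hq3 : 3 ≤ q) (hk : 0 < k)
    (F : Type*) [Field F] [Fintype F] [DecidableEq F] (hcard : Fintype.card F = q) :
    ∃ n : ℕ, 0 < n ∧ ∃ C : Submodule F (Fin n → F),
      Module.finrank F C = k ∧
      (wtSet (C : Set (Fin n → F))).ncard = (q ^ k - 1) / (q - 1) := by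
  classical
  let V := Fin k → F
  let D := Module.Dual F V
  have : Finite D := Module.finite_of_finite F
  have : Fintype D := Fintype.ofFinite D
  let e : D → ℕ := fun d => Fintype.equivFin D d
  have he : Function.Injective e := Fin.val_injective.comp (Fintype.equivFin D).injective
  let ι := Σ d : D, Fin (2 ^ e d)
  let σ := (Fintype.equivFin ι).symm
  let φ : V →ₗ[F] (Fin (Fintype.card ι) → F) := LinearMap.pi fun i => (σ i).1
  have hφ (u : V) : wt (φ u) = ∑ d : D with d u ≠ 0, 2 ^ e d :=
    (wt_comp_equiv σ fun i : ι => i.1 u).trans (wt_sigma_fin (fun d => 2 ^ e d) fun d : D => d u)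
  have hprop {u v : V} (h : wt (φ u) = wt (φ v)) : ∃ a : F, a • v = u := by
    rw [hφ, hφ] at h
    exact exists_smul_eq_of_dual_ne_zero_iff (iff_of_sum_two_pow_eq he h)
  have hinj : Function.Injective φ := by
    refine (injective_iff_map_eq_zero φ).2 fun u hu => ?_
    obtain ⟨a, ha⟩ := hprop (u := u) (v := 0) (by rw [hu, map_zero])
    rw [← ha, smul_zero]
  refine ⟨Fintype.card ι, Fintype.card_pos_iff.2 ⟨⟨0, 0, by positivity⟩⟩, LinearMap.range φ, ?_, ?_⟩
  · rw [LinearMap.finrank_range_of_inj hinj, Module.finrank_fin_fun]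
  · have hset : wtSet (LinearMap.range φ : Set (Fin (Fintype.card ι) → F)) =
        Set.range fun p : Projectivization F V => wt (φ p.rep) := by
      ext w
      constructor
      · rintro ⟨_, ⟨u, rfl⟩, hu, rfl⟩
        have hu0 : u ≠ 0 := fun h => hu (by rw [h, map_zero])
        obtain ⟨a, ha⟩ := Projectivization.exists_smul_eq_mk_rep F u hu0
        refine ⟨Projectivization.mk F u hu0, ?_⟩
        simp only [← ha, Units.smul_def, map_smul]
        exact wt_units_smul a (φ u)
      · rintro ⟨p, rfl⟩
        exact ⟨φ p.rep, ⟨p.rep, rfl⟩, (map_ne_zero_iff φ hinj).2 p.rep_nonzero, rfl⟩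
    have hrep : Function.Injective fun p : Projectivization F V => wt (φ p.rep) := by
      intro p r h
      rw [← p.mk_rep, ← r.mk_rep, Projectivization.mk_eq_mk_iff']
      exact hprop h
    rw [hset, ← Nat.card_coe_set_eq, Nat.card_range_of_injective hrep,
      Projectivization.card'', Nat.card_fun]
    simp [hcard]
end

section
/- For every prime power q, there exists an [n,3]_q maximum weight spectrum code with length n ≤ ((q−1)/2)·(q^3 + q^2 + q). -/
lemma digits_unique {q i j k i' j' k' : ℕ} (hi : i < q) (hi' : i' < q) (hj : j < q) (hj' : j' < q)
    (h : i + q * j + q ^ 2 * k = i' + q * j' + q ^ 2 * k') : i = i' ∧ j = j' ∧ k = k' := by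
  have hq : 0 < q := by omega
  have e1 : i + q * (j + q * k) = i' + q * (j' + q * k') := by linear_combination h
  have h1 : i = i' := by
    simpa [Nat.add_mul_mod_self_left, Nat.mod_eq_of_lt, hi, hi'] using congrArg (· % q) e1
  subst h1
  have e2 : j + q * k = j' + q * k' := Nat.eq_of_mul_eq_mul_left hq (Nat.add_left_cancel e1)
  have h2 : j = j' := by
    simpa [Nat.add_mul_mod_self_left, Nat.mod_eq_of_lt, hj, hj'] using congrArg (· % q) e2
  subst h2
  exact ⟨rfl, rfl, Nat.eq_of_mul_eq_mul_left hq (Nat.add_left_cancel e2)⟩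

lemma exists_discrete_log (G : Type*) [CommGroup G] [IsCyclic G] [Fintype G] :
    ∃ lg : G → ℕ, Function.Injective lg ∧ (∀ a, lg a < Fintype.card G) ∧
      (∀ a b, lg (a * b) = lg a + lg b ∨ lg (a * b) + Fintype.card G = lg a + lg b) ∧
      2 * ∑ a, lg a = Fintype.card G * (Fintype.card G - 1) := by
  let e : Multiplicative (ZMod (Nat.card G)) ≃* G := zmodCyclicMulEquiv inferInstance
  rw [← Nat.card_eq_fintype_card]
  set m := Nat.card G with hm
  have : NeZero m := ⟨Nat.card_pos.ne'⟩
  have hinj : Function.Injective fun a => (e.symm a).toAdd.val :=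
    (ZMod.val_injective m).comp (Multiplicative.toAdd.injective.comp e.symm.injective)
  refine ⟨fun a => (e.symm a).toAdd.val, hinj, fun a => ZMod.val_lt _, fun a b => ?_, ?_⟩
  · simp only [map_mul, toAdd_mul]
    rcases lt_or_ge ((e.symm a).toAdd.val + (e.symm b).toAdd.val) m with h | h
    · exact .inl (ZMod.val_add_of_lt h)
    · exact .inr (ZMod.val_add_val_of_le h).symm
  · have himg : Finset.univ.image (fun a => (e.symm a).toAdd.val) = Finset.range m := by
      refine Finset.eq_of_subset_of_card_le (fun x hx => ?_) ?_
      · obtain ⟨a, -, rfl⟩ := Finset.mem_image.1 hx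
        exact Finset.mem_range.2 (ZMod.val_lt _)
      · rw [Finset.card_image_of_injective _ hinj, Finset.card_range, Finset.card_univ, hm,
          Nat.card_eq_fintype_card]
    rw [← Finset.sum_range_id_mul_two, mul_comm, ← himg,
      Finset.sum_image fun a _ b _ h => hinj h]

lemma exists_encoder {F V P : Type*} [Field F] [DecidableEq F] [AddCommGroup V] [Module F V]
    [Fintype P] (φ : P → V →ₗ[F] F) (μ : P → ℕ) :
    ∃ T : V →ₗ[F] (Fin (∑ p, μ p) → F),
      (∀ u, wt (T u) + ∑ p, (if φ p u = 0 then μ p else 0) = ∑ p, μ p) ∧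
      ∀ u, T u = 0 → ∀ p, μ p ≠ 0 → φ p u = 0 := by
  let e : (Σ p, Fin (μ p)) ≃ Fin (∑ p, μ p) := Fintype.equivFinOfCardEq (by simp)
  refine ⟨LinearMap.pi fun i => φ (e.symm i).1, fun u => ?_, fun u hu p hp => ?_⟩
  · have hwt : wt (LinearMap.pi (fun i => φ (e.symm i).1) u) =
        ∑ p, if φ p u = 0 then 0 else μ p := by
      rw [wt, Finset.card_filter, ← e.sum_comp, Fintype.sum_sigma]
      refine Finset.sum_congr rfl fun p _ => ?_
      by_cases h : φ p u = 0 <;> simp [h]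
    rw [hwt, ← Finset.sum_add_distrib]
    refine Finset.sum_congr rfl fun p _ => ?_
    split_ifs <;> simp
  · simpa using congrFun hu (e ⟨p, ⟨0, Nat.pos_of_ne_zero hp⟩⟩)

lemma wt_smul {ι F : Type*} [Fintype ι] [Field F] [DecidableEq F] {a : F} (ha : a ≠ 0)
    (c : ι → F) : wt (a • c) = wt c := by
  simp [wt, ha]

lemma ncard_wtSet_range {F V ι : Type*} [Field F] [DecidableEq F] [AddCommGroup V]
    [Module F V] [Fintype ι] (T : V →ₗ[F] (ι → F)) (hT : Function.Injective T)
    (h : ∀ u v, u ≠ 0 → v ≠ 0 → wt (T u) = wt (T v) → ∃ a : F, a • v = u) :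
    (wtSet (T.range : Set (ι → F))).ncard = Nat.card (Projectivization F V) := by
  let f : Projectivization F V → ℕ := fun x => wt (T x.rep)
  have hf : Function.Injective f := fun x y hxy => by
    rw [← x.mk_rep, ← y.mk_rep, Projectivization.mk_eq_mk_iff']
    exact h _ _ x.rep_nonzero y.rep_nonzero hxy
  have hr : wtSet (T.range : Set (ι → F)) = Set.range f := by
    ext w
    constructor
    · rintro ⟨_, ⟨u, rfl⟩, hu, rfl⟩
      have hu0 : u ≠ 0 := fun h0 => hu (by simp [h0])
      refine ⟨Projectivization.mk F u hu0, ?_⟩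
      obtain ⟨a, ha⟩ := Projectivization.exists_smul_eq_mk_rep F u hu0
      simp only [f]
      rw [← ha, Units.smul_def, map_smul, wt_smul a.ne_zero]
    · rintro ⟨x, rfl⟩
      exact ⟨_, ⟨x.rep, rfl⟩, fun h0 => x.rep_nonzero (hT (by simpa using h0)), rfl⟩
  rw [hr, ← Set.image_univ, Set.ncard_image_of_injective _ hf, Set.ncard_univ]

/-- The total multiplicity of the zeros of `a ↦ a * b - c` when `a : Fˣ` has multiplicity `lg a`. -/
def sideMult {F : Type*} [Field F] [Fintype F] [DecidableEq F] (lg : Fˣ → ℕ) (b c : F) : ℕ :=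
  ∑ a : Fˣ, if (a : F) * b - c = 0 then lg a else 0

section sideMult

variable {F : Type*} [Field F] [Fintype F] [DecidableEq F] (lg : Fˣ → ℕ)

lemma sideMult_units (b c : Fˣ) : sideMult lg (b : F) c = lg (c / b) := by
  have h (a : Fˣ) : (a : F) * b - c = 0 ↔ a = c / b := by
    rw [sub_eq_zero, ← Units.val_mul, Units.val_inj, eq_div_iff_mul_eq']
  simp [sideMult, h]

lemma sideMult_zero_left (c : Fˣ) : sideMult lg (0 : F) c = 0 := by simp [sideMult]

lemma sideMult_zero_right (b : Fˣ) : sideMult lg (b : F) 0 = 0 := by simp [sideMult]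

lemma sideMult_zero_zero : sideMult lg (0 : F) 0 = ∑ a, lg a := by simp [sideMult]

/-- The multiplicity of the line `[x : y : z]` with respect to a multiset of points supported on
the triangle of reference. -/
def lineMult (m : ℕ) (u : F × F × F) : ℕ :=
  (if u.1 = 0 then m * (m + 1) ^ 2 else 0) + (if u.2.1 = 0 then m else 0) +
    (if u.2.2 = 0 then m * (m + 1) else 0) + sideMult lg u.2.2 u.2.1 +
    (m + 1) * sideMult lg u.2.2 u.1 + (m + 1) ^ 2 * sideMult lg u.1 u.2.1

end sideMult

lemma digits_first_side {m t : ℕ} (hm : 0 < m) (ht : 2 * t = m * (m - 1)) :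
    ∃ d e k, m + m * (m + 1) + t = d + (m + 1) * e + (m + 1) ^ 2 * k ∧
      ∃ h, (m = 2 * h ∧ d = 0 ∧ e + 1 = h ∧ k = 1) ∨
        (m = 2 * h + 1 ∧ d = h + 1 ∧ e + 1 = h ∧ k = 1) ∨ (m = 1 ∧ d = 1 ∧ e = 1 ∧ k = 0) := by
  obtain ⟨h, rfl | rfl⟩ := Nat.even_or_odd' m
  · obtain ⟨g, rfl⟩ : ∃ g, h = g + 1 := ⟨h - 1, by omega⟩
    have : 2 * (g + 1) - 1 = 2 * g + 1 := by omega
    rw [this] at ht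
    exact ⟨0, g, 1, by linarith, g + 1, by omega⟩
  · rw [Nat.add_sub_cancel] at ht
    obtain rfl | ⟨g, rfl⟩ : h = 0 ∨ ∃ g, h = g + 1 := by
      rcases h with _ | g
      exacts [.inl rfl, .inr ⟨g, rfl⟩]
    · exact ⟨1, 1, 0, by omega, 0, by omega⟩
    · exact ⟨g + 2, g, 1, by linarith, g + 1, by omega⟩

lemma digits_second_side {m t : ℕ} (hm : 0 < m) (ht : 2 * t = m * (m - 1)) :
    ∃ e k, m * (m + 1) ^ 2 + m * (m + 1) + (m + 1) * t = (m + 1) * e + (m + 1) ^ 2 * k ∧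
      ∃ h, (m = 2 * h ∧ e = 0 ∧ k = m + h) ∨ (m = 2 * h + 1 ∧ e = h + 1 ∧ k = m + h) := by
  obtain ⟨h, rfl | rfl⟩ := Nat.even_or_odd' m
  · obtain ⟨g, rfl⟩ : ∃ g, h = g + 1 := ⟨h - 1, by omega⟩
    have : 2 * (g + 1) - 1 = 2 * g + 1 := by omega
    rw [this] at ht
    have ht' : t = (g + 1) * (2 * g + 1) := by linarith
    exact ⟨0, 2 * (g + 1) + (g + 1), by rw [ht']; ring, g + 1, by omega⟩
  · rw [Nat.add_sub_cancel] at ht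
    have ht' : t = (2 * h + 1) * h := by linarith
    exact ⟨h + 1, 2 * h + 1 + h, by rw [ht']; ring, h, by omega⟩

lemma div_mul_eq_of_div_eq {F : Type*} [Field F] {a b c d : Fˣ} (h : a / b = c / d) :
    ((b / d : Fˣ) : F) * c = a := by
  rw [← Units.val_mul, Units.val_inj, div_mul_eq_mul_div, mul_div_assoc, ← h, mul_div_cancel]

section

variable {F : Type*} [Field F] [Fintype F] [DecidableEq F]

lemma exists_digits_lineMult {lg : Fˣ → ℕ} {m : ℕ} (hm : 0 < m) (hlt : ∀ a, lg a < m)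
    (hmul : ∀ a b, lg (a * b) = lg a + lg b ∨ lg (a * b) + m = lg a + lg b)
    (hsum : 2 * ∑ a, lg a = m * (m - 1)) (u : F × F × F) (hu : u ≠ 0) :
    ∃ d e k, d < m + 1 ∧ e < m + 1 ∧ lineMult lg m u = d + (m + 1) * e + (m + 1) ^ 2 * k ∧
      ((d < m ∧ e < m ∧ k < m ∧ (d = e + k ∨ d + m = e + k) ∧
          ∃ x y z : Fˣ, u = (↑x, ↑y, ↑z) ∧ d = lg (y / z) ∧ e = lg (x / z)) ∨
        (d < m ∧ e = 0 ∧ k = m ∧ ∃ y z : Fˣ, u = (0, ↑y, ↑z) ∧ d = lg (y / z)) ∨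
        (d = m ∧ e < m ∧ k = 0 ∧ ∃ x z : Fˣ, u = (↑x, 0, ↑z) ∧ e = lg (x / z)) ∨
        (d = 0 ∧ e = m ∧ k < m ∧ ∃ x y : Fˣ, u = (↑x, ↑y, 0) ∧ k = lg (y / x)) ∨
        (d = m ∧ e = 0 ∧ m ≤ k ∧ ∃ z : Fˣ, u = (0, 0, ↑z)) ∨
        ((∃ h, (m = 2 * h ∧ d = 0 ∧ e + 1 = h ∧ k = 1) ∨
            (m = 2 * h + 1 ∧ d = h + 1 ∧ e + 1 = h ∧ k = 1) ∨
            (m = 1 ∧ d = 1 ∧ e = 1 ∧ k = 0)) ∧ ∃ x : Fˣ, u = (↑x, 0, 0)) ∨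
        ((∃ h, (m = 2 * h ∧ d = 0 ∧ e = 0 ∧ k = m + h) ∨
            (m = 2 * h + 1 ∧ d = 0 ∧ e = h + 1 ∧ k = m + h)) ∧ ∃ y : Fˣ, u = (0, ↑y, 0))) := by
  obtain ⟨x, y, z⟩ := u
  have cases_unit (w : F) : w = 0 ∨ ∃ v : Fˣ, w = v := by
    rcases eq_or_ne w 0 with h | h
    exacts [.inl h, .inr ⟨Units.mk0 w h, rfl⟩]
  obtain rfl | ⟨x, rfl⟩ := cases_unit x <;> obtain rfl | ⟨y, rfl⟩ := cases_unit y <;>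
    obtain rfl | ⟨z, rfl⟩ := cases_unit z <;>
    simp only [lineMult, sideMult_units, sideMult_zero_left, sideMult_zero_right,
      sideMult_zero_zero, Units.ne_zero, if_true, if_false]
  · exact absurd rfl hu
  · refine ⟨m, 0, m + ∑ a, lg a, by omega, by omega, by ring, ?_⟩
    exact .inr <| .inr <| .inr <| .inr <| .inl ⟨rfl, rfl, by omega, z, rfl⟩
  · obtain ⟨e, k, h1, h, h2⟩ := digits_second_side hm hsum
    refine ⟨0, e, k, by omega, by omega, by linarith, ?_⟩
    exact .inr <| .inr <| .inr <| .inr <| .inr <| .inr ⟨⟨h, by omega⟩, y, rfl⟩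
  · refine ⟨lg (y / z), 0, m, (hlt _).trans (by omega), by omega, by ring, ?_⟩
    exact .inr <| .inl ⟨hlt _, rfl, rfl, y, z, rfl, rfl⟩
  · obtain ⟨d, e, k, h1, h, h2⟩ := digits_first_side hm hsum
    refine ⟨d, e, k, by omega, by omega, by linarith, ?_⟩
    exact .inr <| .inr <| .inr <| .inr <| .inr <| .inl ⟨⟨h, by omega⟩, x, rfl⟩
  · refine ⟨m, lg (x / z), 0, by omega, (hlt _).trans (by omega), by ring, ?_⟩
    exact .inr <| .inr <| .inl ⟨rfl, hlt _, rfl, x, z, rfl, rfl⟩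
  · refine ⟨0, m, lg (y / x), by omega, by omega, by ring, ?_⟩
    exact .inr <| .inr <| .inr <| .inl ⟨rfl, rfl, hlt _, x, y, rfl, rfl⟩
  · refine ⟨lg (y / z), lg (x / z), lg (y / x), (hlt _).trans (by omega),
      (hlt _).trans (by omega), by ring, ?_⟩
    refine .inl ⟨hlt _, hlt _, hlt _, ?_, x, y, z, rfl, rfl, rfl⟩
    have := hmul (x / z) (y / x)
    rwa [mul_comm (x / z), div_mul_div_cancel] at this

lemma exists_smul_eq_of_lineMult_eq {lg : Fˣ → ℕ} {m : ℕ} (hm : 0 < m)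
    (hinj : Function.Injective lg) (hlt : ∀ a, lg a < m)
    (hmul : ∀ a b, lg (a * b) = lg a + lg b ∨ lg (a * b) + m = lg a + lg b)
    (hsum : 2 * ∑ a, lg a = m * (m - 1)) (u v : F × F × F) (hu : u ≠ 0) (hv : v ≠ 0)
    (h : lineMult lg m u = lineMult lg m v) : ∃ a : F, a • v = u := by
  obtain ⟨d, e, k, hd, he, huW, hu⟩ := exists_digits_lineMult hm hlt hmul hsum u hu
  obtain ⟨d', e', k', hd', he', hvW, hv⟩ := exists_digits_lineMult hm hlt hmul hsum v hv
  obtain ⟨rfl, rfl, rfl⟩ := digits_unique hd hd' he he' (by rw [← huW, ← hvW, h])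
  clear hsum hmul hlt huW hvW h
  rcases hu with ⟨_, _, _, _, x, y, z, rfl, hy, hx⟩ | ⟨_, _, _, y, z, rfl, hy⟩ |
      ⟨_, _, _, x, z, rfl, hx⟩ | ⟨_, _, _, x, y, rfl, hy⟩ | ⟨_, _, _, z, rfl⟩ |
      ⟨⟨g, _⟩, x, rfl⟩ | ⟨⟨g, _⟩, y, rfl⟩ <;>
    rcases hv with ⟨_, _, _, _, x', y', z', rfl, hy', hx'⟩ | ⟨_, _, _, y', z', rfl, hy'⟩ |
      ⟨_, _, _, x', z', rfl, hx'⟩ | ⟨_, _, _, x', y', rfl, hy'⟩ | ⟨_, _, _, z', rfl⟩ |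
      ⟨⟨g', _⟩, x', rfl⟩ | ⟨⟨g', _⟩, y', rfl⟩ <;>
    first
    | (exfalso; omega)
    | skip
  · refine ⟨(z / z' : Fˣ), ?_⟩
    simp only [Prod.smul_mk, smul_eq_mul, div_mul_eq_of_div_eq (hinj (hy.symm.trans hy')),
      div_mul_eq_of_div_eq (hinj (hx.symm.trans hx')), ← Units.val_mul, div_mul_cancel]
  · refine ⟨(z / z' : Fˣ), ?_⟩
    simp only [Prod.smul_mk, smul_eq_mul, div_mul_eq_of_div_eq (hinj (hy.symm.trans hy')),
      mul_zero, ← Units.val_mul, div_mul_cancel]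
  · refine ⟨(z / z' : Fˣ), ?_⟩
    simp only [Prod.smul_mk, smul_eq_mul, div_mul_eq_of_div_eq (hinj (hx.symm.trans hx')),
      mul_zero, ← Units.val_mul, div_mul_cancel]
  · refine ⟨(x / x' : Fˣ), ?_⟩
    simp only [Prod.smul_mk, smul_eq_mul, div_mul_eq_of_div_eq (hinj (hy.symm.trans hy')),
      mul_zero, ← Units.val_mul, div_mul_cancel]
  · refine ⟨(z / z' : Fˣ), ?_⟩
    simp only [Prod.smul_mk, smul_eq_mul, mul_zero, ← Units.val_mul, div_mul_cancel]
  · refine ⟨(x / x' : Fˣ), ?_⟩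
    simp only [Prod.smul_mk, smul_eq_mul, mul_zero, ← Units.val_mul, div_mul_cancel]
  · refine ⟨(y / y' : Fˣ), ?_⟩
    simp only [Prod.smul_mk, smul_eq_mul, mul_zero, ← Units.val_mul, div_mul_cancel]

/-- The points of the triangle of reference, as linear functionals: its three vertices, followed by
the remaining points of its three sides. -/
def trianglePoint : Fin 3 ⊕ Fˣ ⊕ Fˣ ⊕ Fˣ → F × F × F →ₗ[F] F :=
  let x := LinearMap.fst F F (F × F)
  let y := LinearMap.fst F F F ∘ₗ LinearMap.snd F F (F × F)
  let z := LinearMap.snd F F F ∘ₗ LinearMap.snd F F (F × F)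
  Sum.elim ![x, y, z] <| Sum.elim (fun a => (a : F) • z - y) <|
    Sum.elim (fun a => (a : F) • z - x) fun a => (a : F) • x - y

/-- The multiplicities of the points of the triangle of reference. -/
def triangleMult (lg : Fˣ → ℕ) (m : ℕ) : Fin 3 ⊕ Fˣ ⊕ Fˣ ⊕ Fˣ → ℕ :=
  Sum.elim ![m * (m + 1) ^ 2, m, m * (m + 1)] <| Sum.elim lg <|
    Sum.elim (fun a => (m + 1) * lg a) fun a => (m + 1) ^ 2 * lg a

lemma sum_triangleMult (lg : Fˣ → ℕ) (m : ℕ) :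
    ∑ p, triangleMult lg m p = ((m + 1) ^ 2 + (m + 1) + 1) * (m + ∑ a, lg a) := by
  simp only [triangleMult, Fintype.sum_sum_type, Sum.elim_inl, Sum.elim_inr, Fin.sum_univ_three,
    Matrix.cons_val, ← Finset.mul_sum]
  ring

lemma sum_ite_trianglePoint (lg : Fˣ → ℕ) (m : ℕ) (u : F × F × F) :
    ∑ p, (if trianglePoint p u = 0 then triangleMult lg m p else 0) = lineMult lg m u := by
  simp [trianglePoint, triangleMult, Fintype.sum_sum_type, Fin.sum_univ_three, lineMult,
    sideMult, Finset.mul_sum, add_assoc]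
  congr!

end

/-- For every prime power `q`, there exists an `[n,3]_q` maximum weight spectrum code with
length `n ≤ ((q-1)/2)·(q^3 + q^2 + q)`. -/
theorem exists_MWS_dim_three (q : ℕ) (hq : IsPrimePow q)
    (F : Type*) [Field F] [Fintype F] [DecidableEq F] (hcard : Fintype.card F = q) :
    ∃ n : ℕ, n ≤ (q - 1) * (q ^ 3 + q ^ 2 + q) / 2 ∧
      ∃ C : Submodule F (Fin n → F),
        Module.finrank F C = 3 ∧
        (wtSet (C : Set (Fin n → F))).ncard = (q ^ 3 - 1) / (q - 1) := by
  obtain ⟨lg, hinj, hlt, hmul, hsum⟩ := exists_discrete_log Fˣ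
  rw [Fintype.card_units, hcard] at hlt hmul hsum
  obtain ⟨m, rfl⟩ : ∃ m, q = m + 1 := ⟨q - 1, by have := hq.two_le; omega⟩
  have hm : 0 < m := by have := hq.two_le; omega
  simp only [Nat.add_sub_cancel] at hlt hmul hsum ⊢
  obtain ⟨T, hT, hT0⟩ := exists_encoder (trianglePoint (F := F)) (triangleMult lg m)
  simp only [sum_ite_trianglePoint] at hT
  have hTinj : Function.Injective T := by
    refine (injective_iff_map_eq_zero T).2 fun u hu => ?_
    have hx := hT0 u hu (.inl 0) (by simp [triangleMult, hm.ne'])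
    have hy := hT0 u hu (.inl 1) (by simp [triangleMult, hm.ne'])
    have hz := hT0 u hu (.inl 2) (by simp [triangleMult, hm.ne'])
    exact Prod.ext hx (Prod.ext hy hz)
  refine ⟨_, ?_, T.range, ?_, ?_⟩
  · rw [sum_triangleMult, Nat.le_div_iff_mul_le two_pos]
    have h2 : 2 * (m + ∑ a, lg a) = m * (m + 1) := by
      obtain ⟨k, rfl⟩ : ∃ k, m = k + 1 := ⟨m - 1, by omega⟩
      rw [Nat.add_sub_cancel] at hsum
      linarith
    apply le_of_eq
    linear_combination ((m + 1) ^ 2 + (m + 1) + 1) * h2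
  · rw [LinearMap.finrank_range_of_inj hTinj]
    simp
  · rw [ncard_wtSet_range T hTinj fun u v hu hv h =>
      exists_smul_eq_of_lineMult_eq hm hinj hlt hmul hsum u v hu hv ?_]
    · rw [Projectivization.card'']
      simp only [Nat.card_prod, Nat.card_eq_fintype_card (α := F), hcard, Nat.add_sub_cancel]
      congr 2
      ring
    · have := hT u
      have := hT v
      omega
end
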